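/- arXiv:2511.14443 — 2 statements merged into one kernel-verified Lean document; each statement's English description precedes it below -/
import Mathlib

section
/- (Case m = 2.) One has the factorization I_n − Γ S = Z D_3 D_2, where Z ∈ ℝ^{n×(n−2)} is the lower triangular matrix whose only nonzero entries are, for 1 ≤ j ≤ n−2: z_{j,j} = (θ_{j+2}−θ_{j+1})(θ_{j+3}−θ_{j+2})² / (18(θ_{j+3}−θ_{j+1})), z_{j+1,j} = −(θ_{j+2}−θ_{j+1})(θ_{j+3}−θ_{j+2})/18, and z_{j+2,j} = (θ_{j+2}−θ_{j+1})²(θ_{j+3}−θ_{j+2}) / (18(θ_{j+3}−θ_{j+1})). -/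
open scoped BigOperators
open MeasureTheory Matrix

noncomputable def omegaB (θ : ℕ → ℝ) (j k : ℕ) (x : ℝ) : ℝ :=
  if θ k < θ (k + j) then (x - θ k) / (θ (k + j) - θ k) else 0

noncomputable def Nspl (θ : ℕ → ℝ) : ℕ → ℕ → ℝ → ℝ
  | 0, _, _ => 0
  | 1, k, x => if θ k ≤ x ∧ x < θ (k + 1) then 1 else 0
  | j + 2, k, x =>
      omegaB θ (j + 1) k x * Nspl θ (j + 1) k x
        + (1 - omegaB θ (j + 1) (k + 1) x) * Nspl θ (j + 1) (k + 1) x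

noncomputable def Gram (θ : ℕ → ℝ) (a b : ℝ) (m n : ℕ) : Matrix (Fin n) (Fin n) ℝ :=
  Matrix.of fun j k => ∫ x in a..b, Nspl θ m (j.1 + 1) x * Nspl θ m (k.1 + 1) x

noncomputable def Dmat (θ : ℕ → ℝ) (ord p q : ℕ) : Matrix (Fin p) (Fin q) ℝ :=
  Matrix.of fun k j =>
    if j.1 = k.1 then (ord : ℝ) / (θ (k.1 + 1 + ord) - θ (k.1 + 1))
    else if j.1 = k.1 + 1 then -((ord : ℝ) / (θ (k.1 + 2 + ord) - θ (k.1 + 2)))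
    else 0

noncomputable def Dprod (θ : ℕ → ℝ) (m n : ℕ) : (ν : ℕ) → Matrix (Fin (n - ν - 1)) (Fin n) ℝ
  | 0 => Dmat θ m (n - 1) n
  | ν + 1 => Dmat θ (m + ν + 1) (n - (ν + 1) - 1) (n - ν - 1) * Dprod θ m n ν

noncomputable def DprodFull (θ : ℕ → ℝ) (m n : ℕ) (hm : 1 ≤ m) :
    Matrix (Fin (n - m)) (Fin n) ℝ :=
  Matrix.reindex (finCongr (by omega : n - (m - 1) - 1 = n - m)) (Equiv.refl _)
    (Dprod θ m n (m - 1))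

noncomputable def knotMult (θ : ℕ → ℝ) (N ℓ : ℕ) : ℕ :=
  ((Finset.Icc 1 N).filter fun i => θ i = θ ℓ).card

structure IsOpenKnot (θ : ℕ → ℝ) (a b : ℝ) (m n : ℕ) : Prop where
  mono : ∀ i, 1 ≤ i → i < n + m → θ i ≤ θ (i + 1)
  left : ∀ i, 1 ≤ i → i ≤ m → θ i = a
  right : ∀ i, n + 1 ≤ i → i ≤ n + m → θ i = b
  intMult : ∀ k, m + 1 ≤ k → k ≤ n → knotMult θ (n + m) k ≤ m - 1

noncomputable def esymmF (r : ℕ) (s : Finset ℕ) (y : ℕ → ℝ) : ℝ :=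
  ∑ t ∈ s.powersetCard r, ∏ i ∈ t, y i

noncomputable def cVec (θ : ℕ → ℝ) (m n ℓ ν : ℕ) : Fin n → ℝ :=
  fun k =>
    if k.1 + 1 ≤ ℓ - m + ν then
      esymmF (m - 1 - ν) (Finset.Icc (k.1 + 2) (k.1 + m)) (fun i => θ ℓ - θ i)
        / ((m - 1).choose ν : ℝ)
    else 0

noncomputable def Fpoly (ν : ℕ) (s : Finset ℕ) (y : ℕ → ℝ) : ℝ :=
  (2 ^ ν * (ν.factorial : ℝ))⁻¹ *
    ∑ f ∈ (Fintype.piFinset fun _ : Fin (2 * ν) => s).filter (fun f => Function.Injective f),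
      ∏ i : Fin ν,
        (y (f ⟨i.1, by have := i.2; omega⟩) - y (f ⟨ν + i.1, by have := i.2; omega⟩)) ^ 2

noncomputable def uCoef (θ : ℕ → ℝ) (m ν k : ℕ) : ℝ :=
  ((m + ν : ℕ) : ℝ) / (θ (k + m + ν) - θ k) * Fpoly ν (Finset.Icc (k + 1) (k + m + ν - 1)) θ

noncomputable def Smat (θ : ℕ → ℝ) (m n : ℕ) : ℕ → Matrix (Fin n) (Fin n) ℝ
  | 0 => Matrix.diagonal fun k : Fin n => uCoef θ m 0 (k.1 + 1)
  | ν + 1 => Smat θ m n ν +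
      (Dprod θ m n ν)ᵀ *
        Matrix.diagonal (fun k : Fin (n - ν - 1) => uCoef θ m (ν + 1) (k.1 + 1)) *
        Dprod θ m n ν
noncomputable def alpha2 (θ : ℕ → ℝ) (n j : ℕ) : ℝ :=
  if 1 ≤ j ∧ j ≤ n - 1 then (θ (j + 2) - θ (j + 1)) ^ 2 / (θ (j + 3) - θ j) else 0

noncomputable def beta2 (θ : ℕ → ℝ) (j : ℕ) : ℝ :=
  -(2 * (θ (j + 2) - θ (j + 1)) ^ 2) /
    ((θ (j + 2) - θ j) * (θ (j + 3) - θ j) * (θ (j + 3) - θ (j + 1)))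

/-- The approximate-dual matrix `S` for `m = 2` (symmetric tridiagonal). -/
noncomputable def S2 (θ : ℕ → ℝ) (n : ℕ) : Matrix (Fin n) (Fin n) ℝ :=
  Matrix.of fun i k =>
    if k.1 = i.1 then
      2 / (θ (i.1 + 3) - θ (i.1 + 1))
        + 2 * (alpha2 θ n i.1 + alpha2 θ n (i.1 + 1)) / (θ (i.1 + 3) - θ (i.1 + 1)) ^ 2
    else if k.1 = i.1 + 1 then beta2 θ (i.1 + 1)
    else if i.1 = k.1 + 1 then beta2 θ (k.1 + 1)
    else 0

/-- The explicit matrix `Z` for `m = 2` (lower triangular, three nonzero diagonals). -/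
noncomputable def Zmat2 (θ : ℕ → ℝ) (n : ℕ) : Matrix (Fin n) (Fin (n - 2)) ℝ :=
  Matrix.of fun i j =>
    if i.1 = j.1 then
      (θ (j.1 + 3) - θ (j.1 + 2)) * (θ (j.1 + 4) - θ (j.1 + 3)) ^ 2
        / (18 * (θ (j.1 + 4) - θ (j.1 + 2)))
    else if i.1 = j.1 + 1 then
      -((θ (j.1 + 3) - θ (j.1 + 2)) * (θ (j.1 + 4) - θ (j.1 + 3)) / 18)
    else if i.1 = j.1 + 2 then
      (θ (j.1 + 3) - θ (j.1 + 2)) ^ 2 * (θ (j.1 + 4) - θ (j.1 + 3))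
        / (18 * (θ (j.1 + 4) - θ (j.1 + 2)))
    else 0

/-- The approximate-dual matrix `S = U₀ + D₃ᵀ U₁ D₃ + D₃ᵀ D₄ᵀ U₂ D₄ D₃` for `m = 3`. -/
noncomputable def S3 (θ : ℕ → ℝ) (n : ℕ) : Matrix (Fin n) (Fin n) ℝ :=
  Matrix.diagonal (fun k : Fin n => uCoef θ 3 0 (k.1 + 1))
    + (Dmat θ 3 (n - 1) n)ᵀ *
        Matrix.diagonal (fun k : Fin (n - 1) => uCoef θ 3 1 (k.1 + 1)) * Dmat θ 3 (n - 1) n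
    + (Dmat θ 4 (n - 2) (n - 1) * Dmat θ 3 (n - 1) n)ᵀ *
        Matrix.diagonal (fun k : Fin (n - 2) => uCoef θ 3 2 (k.1 + 1)) *
        (Dmat θ 4 (n - 2) (n - 1) * Dmat θ 3 (n - 1) n)

noncomputable section Helpers

def alz (T : ℤ → ℝ) (j : ℤ) : ℝ := (T (j + 2) - T (j + 1)) ^ 2 / (T (j + 3) - T j)

def bez (T : ℤ → ℝ) (j : ℤ) : ℝ :=
  -(2 * (T (j + 2) - T (j + 1)) ^ 2) /
    ((T (j + 2) - T j) * (T (j + 3) - T j) * (T (j + 3) - T (j + 1)))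

def Sz (T : ℤ → ℝ) (i k : ℤ) : ℝ :=
  if k = i then 2 / (T (i + 3) - T (i + 1))
        + 2 * (alz T i + alz T (i + 1)) / (T (i + 3) - T (i + 1)) ^ 2
  else if k = i + 1 then bez T (i + 1)
  else if i = k + 1 then bez T (k + 1)
  else 0

def Gz (T : ℤ → ℝ) (i k : ℤ) : ℝ :=
  if k = i then (T (i + 3) - T (i + 1)) / 3
  else if k = i + 1 then (T (i + 3) - T (i + 2)) / 6
  else if i = k + 1 then (T (i + 2) - T (i + 1)) / 6
  else 0

def Dz (T : ℤ → ℝ) (o : ℤ) (k j : ℤ) : ℝ :=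
  if j = k then (o : ℝ) / (T (k + 1 + o) - T (k + 1))
  else if j = k + 1 then -((o : ℝ) / (T (k + 2 + o) - T (k + 2)))
  else 0

def Zz (T : ℤ → ℝ) (i j : ℤ) : ℝ :=
    if i = j then
      (T (j + 3) - T (j + 2)) * (T (j + 4) - T (j + 3)) ^ 2
        / (18 * (T (j + 4) - T (j + 2)))
    else if i = j + 1 then
      -((T (j + 3) - T (j + 2)) * (T (j + 4) - T (j + 3)) / 18)
    else if i = j + 2 then
      (T (j + 3) - T (j + 2)) ^ 2 * (T (j + 4) - T (j + 3))
        / (18 * (T (j + 4) - T (j + 2)))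
    else 0

def DDz (T : ℤ → ℝ) (j k : ℤ) : ℝ :=
  Dz T 3 j j * Dz T 2 j k + Dz T 3 j (j + 1) * Dz T 2 (j + 1) k

theorem sum3 (n : ℕ) (F : ℤ → ℝ) (i : ℤ)
    (hz : ∀ j, j ≠ i - 1 → j ≠ i → j ≠ i + 1 → F j = 0)
    (h0 : ∀ j, j < 0 → F j = 0) (h1 : ∀ j, (n : ℤ) ≤ j → F j = 0) :
    ∑ j : Fin n, F (j.1 : ℤ) = F (i - 1) + F i + F (i + 1) := by
  have e1 : ∑ j : Fin n, F (j.1 : ℤ) = ∑ j ∈ (Finset.range n).map Nat.castEmbedding, F j := by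
    rw [Finset.sum_map]
    exact Fin.sum_univ_eq_sum_range (fun j => F (j : ℤ)) n
  have e2 : ∑ j ∈ ({i - 1, i, i + 1} : Finset ℤ), F j = F (i - 1) + F i + F (i + 1) := by
    rw [Finset.sum_insert, Finset.sum_insert, Finset.sum_singleton]
    · ring
    · simp
    · simp; omega
  rw [e1, ← e2, ← finsum_eq_sum_of_support_subset, ← finsum_eq_sum_of_support_subset]
  · intro j hj
    by_contra hc
    apply hj
    simp only [Finset.coe_insert, Finset.coe_singleton, Set.mem_insert_iff,
      Set.mem_singleton_iff, not_or] at hc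
    exact hz j hc.1 hc.2.1 hc.2.2
  · intro j hj
    by_contra hc
    apply hj
    by_cases hj0 : j < 0
    · exact h0 j hj0
    · apply h1
      by_contra hlt
      apply hc
      simp only [Finset.coe_map, Set.mem_image, Finset.mem_coe, Finset.mem_range]
      exact ⟨j.toNat, by omega, by simp; omega⟩

set_option maxHeartbeats 4000000 in
theorem mainz (T : ℤ → ℝ) (hm : Monotone T) (h2 : ∀ j, T j < T (j + 2)) (i k : ℤ) :
    (if i = k then (1 : ℝ) else 0)
      - (Gz T i (i - 1) * Sz T (i - 1) k + Gz T i i * Sz T i k + Gz T i (i + 1) * Sz T (i + 1) k)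
    = Zz T i (i - 1 - 1) * DDz T (i - 1 - 1) k + Zz T i (i - 1) * DDz T (i - 1) k
      + Zz T i (i - 1 + 1) * DDz T (i - 1 + 1) k := by
  obtain ⟨c, rfl⟩ : ∃ c, k = i + c := ⟨k - i, by ring⟩
  have q2 : ∀ j, T (j + 2) - T j ≠ 0 := fun j => (sub_pos.2 (h2 j)).ne'
  have q3 : ∀ j, T (j + 3) - T j ≠ 0 := fun j =>
    (sub_pos.2 ((h2 j).trans_le (hm (by omega)))).ne'
  have a1 := q2 (i - 1)
  have a2 := q2 i
  have a3 := q2 (i + 1)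
  have a4 := q2 (i + 2)
  have a5 := q2 (i + 3)
  have b1 := q3 (i - 1)
  have b2 := q3 i
  have b3 := q3 (i + 1)
  have b4 := q3 (i + 2)
  by_cases hc : c < -2 ∨ 2 < c
  · have c0 : c ≠ 0 := by omega
    have c1 : c ≠ 1 := by omega
    have c2 : c ≠ 2 := by omega
    have c3 : c ≠ -1 := by omega
    have c4 : c ≠ -2 := by omega
    have e1 : i ≠ i + c := by omega
    have e2 : i ≠ i + (c + 1) := by omega
    have e3 : i + 1 ≠ i + (c + 1) := by omega
    have e4 : i + -1 ≠ i + (c + 1) := by omega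
    simp [Gz, Sz, DDz, Dz, sub_eq_add_neg, add_assoc, c0, c1, c2, c3, c4, e1, e2, e3, e4]
  · have : c = -2 ∨ c = -1 ∨ c = 0 ∨ c = 1 ∨ c = 2 := by omega
    clear hc q2 q3 h2 hm
    rcases this with rfl | rfl | rfl | rfl | rfl <;>
    simp [Gz, Sz, Zz, DDz, Dz, alz, bez, sub_eq_add_neg, add_assoc] at * <;>
    generalize T (i + -1) = y0 at * <;>
    generalize T i = y1 at * <;>
    generalize T (i + 1) = y2 at * <;>
    generalize T (i + 2) = y3 at * <;>
    generalize T (i + 3) = y4 at * <;>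
    generalize T (i + 4) = y5 at * <;>
    generalize T (i + 5) = y6 at * <;>
    simp only [← sub_eq_add_neg] at * <;>
    field_simp <;> ring

theorem int_ite (a b c d : ℝ) (f : ℝ → ℝ) (hf : Continuous f) (hac : a ≤ c) (hcd : c ≤ d)
    (hdb : d ≤ b) :
    IntervalIntegrable (fun x => if c ≤ x ∧ x < d then f x else 0) volume a b ∧
    ∫ x in a..b, (if c ≤ x ∧ x < d then f x else 0) = ∫ x in c..d, f x := by
  have hI : (fun x => if c ≤ x ∧ x < d then f x else 0) = (Set.Ico c d).indicator f := by
    ext x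
    simp [Set.indicator, Set.mem_Ico]
  have hab : a ≤ b := hac.trans (hcd.trans hdb)
  have hint : Integrable ((Set.Ico c d).indicator f) volume := by
    rw [integrable_indicator_iff measurableSet_Ico]
    exact (hf.continuousOn.integrableOn_Icc).mono_set Set.Ico_subset_Icc_self
  refine ⟨?_, ?_⟩
  · rw [hI]
    exact hint.intervalIntegrable
  · rw [hI, intervalIntegral.integral_of_le hab, intervalIntegral.integral_of_le hcd,
      ← integral_Icc_eq_integral_Ioc, setIntegral_indicator measurableSet_Ico,
      ← integral_Ico_eq_integral_Ioc]
    congr 2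
    ext x
    simp only [Set.mem_inter_iff, Set.mem_Icc, Set.mem_Ico]
    constructor
    · exact fun h => h.2
    · exact fun h => ⟨⟨hac.trans h.1, h.2.le.trans hdb⟩, h⟩

/-- rising and falling halves of the hat functions -/
def hatA (θ : ℕ → ℝ) (k : ℕ) (x : ℝ) : ℝ := omegaB θ 1 k x * Nspl θ 1 k x
def hatB (θ : ℕ → ℝ) (k : ℕ) (x : ℝ) : ℝ := (1 - omegaB θ 1 k x) * Nspl θ 1 k x

theorem Nspl_two (θ : ℕ → ℝ) (k : ℕ) (x : ℝ) :
    Nspl θ 2 k x = hatA θ k x + hatB θ (k + 1) x := by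
  simp [Nspl, hatA, hatB]

theorem pint (c d p q r s : ℝ) (h : c < d) :
    ∫ x in c..d, (p + q * ((x - c) / (d - c))) * (r + s * ((x - c) / (d - c)))
      = (d - c) * (p * r + (p * s + q * r) / 2 + q * s / 3) := by
  have hd : d - c ≠ 0 := (sub_pos.2 h).ne'
  have key : ∀ x ∈ Set.uIcc c d, HasDerivAt (fun x => (d - c) * (p * r * ((x - c) / (d - c))
      + (p * s + q * r) * ((x - c) / (d - c)) ^ 2 / 2 + q * s * ((x - c) / (d - c)) ^ 3 / 3))
      ((p + q * ((x - c) / (d - c))) * (r + s * ((x - c) / (d - c)))) x := by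
    intro x _
    have hu : HasDerivAt (fun x => (x - c) / (d - c)) (1 / (d - c)) x :=
      ((hasDerivAt_id x).sub_const c).div_const _
    have := ((((hu.const_mul (p * r)).add (((hu.pow 2).const_mul (p * s + q * r)).div_const 2)).add
      (((hu.pow 3).const_mul (q * s)).div_const 3)).const_mul (d - c))
    refine this.congr_deriv ?_
    have e : d - c ≠ 0 := hd
    generalize d - c = w at e
    generalize x - c = u
    norm_num
    field_simp
    ring
  rw [intervalIntegral.integral_eq_sub_of_hasDerivAt key]
  · field_simp
    ring
  · apply Continuous.intervalIntegrable
    fun_prop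

theorem pairInt (θ : ℕ → ℝ) (a b : ℝ) (k l : ℕ) (p q r s : ℝ)
    (ha : a ≤ θ k) (hk : θ k ≤ θ (k + 1)) (hb : θ (k + 1) ≤ b)
    (hd : k ≠ l → θ (k + 1) ≤ θ l ∨ θ (l + 1) ≤ θ k) :
    IntervalIntegrable (fun x => ((p + q * omegaB θ 1 k x) * Nspl θ 1 k x) *
      ((r + s * omegaB θ 1 l x) * Nspl θ 1 l x)) volume a b ∧
    ∫ x in a..b, ((p + q * omegaB θ 1 k x) * Nspl θ 1 k x) *
      ((r + s * omegaB θ 1 l x) * Nspl θ 1 l x)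
      = if k = l then (θ (k + 1) - θ k) * (p * r + (p * s + q * r) / 2 + q * s / 3) else 0 := by
  by_cases hkl : k = l
  · subst hkl
    rcases hk.eq_or_lt with he | hlt
    · have : (fun x => ((p + q * omegaB θ 1 k x) * Nspl θ 1 k x) *
          ((r + s * omegaB θ 1 k x) * Nspl θ 1 k x)) = fun _ => 0 := by
        ext x
        have : ¬ (θ k ≤ x ∧ x < θ (k + 1)) := by
          rintro ⟨h1, h2⟩
          linarith
        simp [Nspl, this]
      rw [this]
      simp [he]
    · have : (fun x => ((p + q * omegaB θ 1 k x) * Nspl θ 1 k x) *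
          ((r + s * omegaB θ 1 k x) * Nspl θ 1 k x)) = fun x => if θ k ≤ x ∧ x < θ (k + 1) then
          (p + q * ((x - θ k) / (θ (k + 1) - θ k))) * (r + s * ((x - θ k) / (θ (k + 1) - θ k)))
          else 0 := by
        ext x
        by_cases hx : θ k ≤ x ∧ x < θ (k + 1)
        · simp [Nspl, omegaB, hx, hlt]
        · simp [Nspl, hx]
      rw [this]
      have := int_ite a b (θ k) (θ (k + 1)) (fun x => (p + q * ((x - θ k) / (θ (k + 1) - θ k))) *
        (r + s * ((x - θ k) / (θ (k + 1) - θ k)))) (by fun_prop) ha hk hb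
      refine ⟨this.1, ?_⟩
      rw [this.2, pint _ _ _ _ _ _ hlt, if_pos rfl]
  · have : (fun x => ((p + q * omegaB θ 1 k x) * Nspl θ 1 k x) *
        ((r + s * omegaB θ 1 l x) * Nspl θ 1 l x)) = fun _ => 0 := by
      ext x
      by_cases h1 : θ k ≤ x ∧ x < θ (k + 1)
      · have : ¬ (θ l ≤ x ∧ x < θ (l + 1)) := by
          rintro ⟨h3, h4⟩
          rcases hd hkl with h | h <;> linarith [h1.1, h1.2]
        simp [Nspl, this]
      · simp [Nspl, h1]
    rw [this]
    simp [hkl]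

theorem hatA_eq (θ : ℕ → ℝ) (k : ℕ) (x : ℝ) :
    hatA θ k x = (0 + 1 * omegaB θ 1 k x) * Nspl θ 1 k x := by simp [hatA]

theorem hatB_eq (θ : ℕ → ℝ) (k : ℕ) (x : ℝ) :
    hatB θ k x = (1 + (-1) * omegaB θ 1 k x) * Nspl θ 1 k x := by
  unfold hatB
  ring

theorem gram_eq (θ : ℕ → ℝ) (N : ℕ) (hm : ∀ i j, 1 ≤ i → i ≤ j → j ≤ N → θ i ≤ θ j)
    (j k : ℕ) (hj : 1 ≤ j) (hk : 1 ≤ k) (hj2 : j + 2 ≤ N) (hk2 : k + 2 ≤ N) :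
    ∫ x in θ 1..θ N, Nspl θ 2 j x * Nspl θ 2 k x =
      if k = j then (θ (j + 2) - θ j) / 3
      else if k = j + 1 then (θ (j + 2) - θ (j + 1)) / 6
      else if j = k + 1 then (θ (j + 1) - θ j) / 6
      else 0 := by
  have P : ∀ (u v : ℕ) (p q r s : ℝ), 1 ≤ u → 1 ≤ v → u + 1 ≤ N → v + 1 ≤ N → _ :=
    fun u v p q r s h1 h2 h3 h4 => pairInt θ (θ 1) (θ N) u v p q r s (hm _ _ le_rfl h1 (by omega))
      (hm _ _ h1 (by omega) h3) (hm _ _ (by omega) h3 le_rfl) (by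
        intro hne
        rcases lt_or_gt_of_ne hne with h | h
        · exact Or.inl (hm _ _ (by omega) (by omega) (by omega))
        · exact Or.inr (hm _ _ (by omega) (by omega) (by omega)))
  have AA := P j k 0 1 0 1 hj hk (by omega) (by omega)
  have AB := P j (k + 1) 0 1 1 (-1) hj (by omega) (by omega) (by omega)
  have BA := P (j + 1) k 1 (-1) 0 1 (by omega) hk (by omega) (by omega)
  have BB := P (j + 1) (k + 1) 1 (-1) 1 (-1) (by omega) (by omega) (by omega) (by omega)
  simp only [← hatA_eq, ← hatB_eq] at AA AB BA BB
  have e : (fun x => Nspl θ 2 j x * Nspl θ 2 k x) = fun x =>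
      ((hatA θ j x * hatA θ k x + hatA θ j x * hatB θ (k + 1) x) + hatB θ (j + 1) x * hatA θ k x)
      + hatB θ (j + 1) x * hatB θ (k + 1) x := by
    ext x
    rw [Nspl_two, Nspl_two]
    ring
  rw [e, intervalIntegral.integral_add ((AA.1.add AB.1).add BA.1) BB.1,
    intervalIntegral.integral_add (AA.1.add AB.1) BA.1,
    intervalIntegral.integral_add AA.1 AB.1, AA.2, AB.2, BA.2, BB.2]
  by_cases h1 : k = j
  · subst h1
    simp
    ring
  · by_cases h2 : k = j + 1
    · subst h2
      have g : j ≠ j + 1 + 1 := by omega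
      simp [g]
      ring
    · by_cases h3 : j = k + 1
      · subst h3
        have g : k ≠ k + 1 + 1 := by omega
        have g' : k + 1 + 1 ≠ k := by omega
        simp [g, g']
        ring
      · have : j ≠ k := fun h => h1 h.symm
        have : j + 1 ≠ k := fun h => h2 h.symm
        simp [*]

theorem extend (n : ℕ) (hn : 2 ≤ n) (θ : ℕ → ℝ) (h12 : θ 1 = θ 2) (hN : θ (n + 1) = θ (n + 2))
    (hstrict : ∀ i, 2 ≤ i → i ≤ n → θ i < θ (i + 1)) :
    ∃ T : ℤ → ℝ, Monotone T ∧ (∀ j, T j < T (j + 2)) ∧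
      ∀ m : ℕ, 1 ≤ m → m ≤ n + 2 → θ m = T m := by
  let T : ℤ → ℝ := fun j => if j < 1 then θ 1 + (j - 1 : ℤ) else if j ≤ n + 2 then θ j.toNat
    else θ (n + 2) + (j - (n + 2) : ℤ)
  have hT : ∀ m : ℕ, 1 ≤ m → m ≤ n + 2 → θ m = T m := by
    intro m h1 h2
    have a : ¬ ((m : ℤ) < 1) := by omega
    have b : (m : ℤ) ≤ n + 2 := by omega
    simp only [T, a, b, if_true, if_false, Int.toNat_natCast]
  have hlt : ∀ j : ℤ, j ≠ 1 → j ≠ n + 1 → T j < T (j + 1) := by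
    intro j h1 h2
    rcases lt_trichotomy j 0 with h | h | h
    · have a : j < 1 := by omega
      have b : j + 1 < 1 := by omega
      simp only [T, a, b, if_true]
      push_cast
      linarith
    · subst h
      simp [T]
      split_ifs
      · linarith
      · omega
    · by_cases h3 : j ≤ n
      · obtain ⟨m, rfl⟩ := Int.eq_ofNat_of_zero_le h.le
        have := hstrict m (by omega) (by omega)
        rw [hT m (by omega) (by omega), hT (m + 1) (by omega) (by omega)] at this
        exact_mod_cast this
      · by_cases h4 : j = n + 2
        · subst h4
          rw [← Nat.cast_ofNat, ← Nat.cast_add, ← hT (n + 2) (by omega) le_rfl]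
          have a : ¬ (((n + 2 : ℕ) : ℤ) + 1 < 1) := by omega
          have b : ¬ (((n + 2 : ℕ) : ℤ) + 1 ≤ n + 2) := by omega
          simp only [T, a, b, if_false]
          push_cast
          linarith
        · have a : ¬ (j < 1) := by omega
          have b : ¬ (j ≤ n + 2) := by omega
          have a' : ¬ (j + 1 < 1) := by omega
          have b' : ¬ (j + 1 ≤ n + 2) := by omega
          simp only [T, a, b, a', b', if_false]
          push_cast
          linarith
  have e1 : T 1 = T (1 + 1) := by
    have := h12
    rw [hT 1 le_rfl (by omega), hT 2 (by omega) (by omega)] at this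
    exact_mod_cast this
  have e2 : T (n + 1) = T (n + 1 + 1) := by
    have := hN
    rw [hT (n + 1) (by omega) (by omega), hT (n + 2) (by omega) (by omega)] at this
    exact_mod_cast this
  have hle : ∀ j : ℤ, T j ≤ T (j + 1) := by
    intro j
    by_cases h1 : j = 1
    · subst h1
      exact e1.le
    · by_cases h2 : j = n + 1
      · subst h2
        exact e2.le
      · exact (hlt j h1 h2).le
  refine ⟨T, monotone_int_of_le_succ hle, ?_, hT⟩
  intro j
  have e : j + 2 = j + 1 + 1 := by ring
  rw [e]
  by_cases h : j = 1 ∨ j = n + 1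
  · exact (hle j).trans_lt (hlt (j + 1) (by omega) (by omega))
  · exact (hlt j (by omega) (by omega)).trans_le (hle (j + 1))

end Helpers

/-- case `m = 2`. The factorization `Iₙ - Γ S = Z D₃ D₂` holds with the
explicit lower triangular matrix `Z`. -/
theorem stmt6 (a b : ℝ) (hab : a < b) (n : ℕ) (hn : 2 ≤ n) (θ : ℕ → ℝ)
    (hθ1 : θ 1 = a) (hθ2 : θ 2 = a) (hθ3 : θ (n + 1) = b) (hθ4 : θ (n + 2) = b)
    (hstrict : ∀ i, 2 ≤ i → i ≤ n → θ i < θ (i + 1))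
    :
    (1 : Matrix (Fin n) (Fin n) ℝ) - Gram θ a b 2 n * S2 θ n
      = Zmat2 θ n * (Dmat θ 3 (n - 2) (n - 1) * Dmat θ 2 (n - 1) n) := by
  obtain ⟨T, hmono, h2, hT⟩ := extend n hn θ (hθ1.trans hθ2.symm) (hθ3.trans hθ4.symm) hstrict
  have hm : ∀ i j, 1 ≤ i → i ≤ j → j ≤ n + 2 → θ i ≤ θ j := by
    intro i j h1 h2 h3
    rw [hT i h1 (by omega), hT j (by omega) h3]
    exact hmono (by omega)
  have hA : T 2 - T 1 = 0 := by
    have := hθ2.trans hθ1.symm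
    rw [hT 1 le_rfl (by omega), hT 2 (by omega) (by omega)] at this
    exact sub_eq_zero.2 (by exact_mod_cast this)
  have hB : T (n + 2) - T (n + 1) = 0 := by
    have := hθ4.trans hθ3.symm
    rw [hT (n + 1) (by omega) (by omega), hT (n + 2) (by omega) (by omega)] at this
    exact sub_eq_zero.2 (by exact_mod_cast this)
  have hal : ∀ i, i ≤ n → alpha2 θ n i = alz T i := by
    intro i hi
    unfold alpha2 alz
    split_ifs with h
    · rw [hT (i + 2) (by omega) (by omega), hT (i + 1) (by omega) (by omega),
        hT (i + 3) (by omega) (by omega), hT i (by omega) (by omega)]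
      push_cast
      rfl
    · have : i = 0 ∨ i = n := by omega
      rcases this with rfl | rfl
      · simp [hA]
      · simp [hB]
  have hbe : ∀ i, 1 ≤ i → i + 1 ≤ n → beta2 θ i = bez T i := by
    intro i h1 hi
    unfold beta2 bez
    rw [hT (i + 2) (by omega) (by omega), hT (i + 1) (by omega) (by omega),
        hT (i + 3) (by omega) (by omega), hT i (by omega) (by omega)]
    push_cast
    rfl
  have hS : ∀ i k : Fin n, S2 θ n i k = Sz T i.1 k.1 := by
    intro i k
    have hi := i.2
    have hk := k.2
    simp only [S2, Sz, Matrix.of_apply]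
    split_ifs with g1 g2 g3 g4 g5 g6 <;> first | omega | skip
    · rw [hal _ (by omega), hal _ (by omega), hT (i + 3) (by omega) (by omega),
        hT (i + 1) (by omega) (by omega)]
      push_cast
      rfl
    · rw [hbe _ (by omega) (by omega)]
      push_cast
      rfl
    · rw [hbe _ (by omega) (by omega)]
      push_cast
      rfl
    · rfl
  have hG : ∀ i k : Fin n, Gram θ a b 2 n i k = Gz T i.1 k.1 := by
    intro i k
    have hi := i.2
    have hk := k.2
    simp only [Gram, Matrix.of_apply]
    rw [← hθ1, ← hθ4, gram_eq θ (n + 2) hm _ _ (by omega) (by omega) (by omega) (by omega),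
      hT (i.1 + 1 + 2) (by omega) (by omega), hT (i.1 + 1 + 1) (by omega) (by omega),
      hT (i.1 + 1) (by omega) (by omega)]
    push_cast
    simp only [Gz, add_assoc]
    split_ifs with g1 g2 g3 g4 g5 g6 <;> first | omega | norm_num
  have hD2 : ∀ (i : Fin (n - 1)) (k : Fin n), Dmat θ 2 (n - 1) n i k = Dz T 2 i.1 k.1 := by
    intro i k
    have hi := i.2
    simp only [Dmat, Matrix.of_apply, Dz]
    rw [hT (i.1 + 1 + 2) (by omega) (by omega), hT (i.1 + 2 + 2) (by omega) (by omega),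
      hT (i.1 + 1) (by omega) (by omega), hT (i.1 + 2) (by omega) (by omega)]
    push_cast
    split_ifs <;> first | omega | rfl
  have hD3 : ∀ (i : Fin (n - 2)) (k : Fin (n - 1)),
      Dmat θ 3 (n - 2) (n - 1) i k = Dz T 3 i.1 k.1 := by
    intro i k
    have hi := i.2
    simp only [Dmat, Matrix.of_apply, Dz]
    rw [hT (i.1 + 1 + 3) (by omega) (by omega), hT (i.1 + 2 + 3) (by omega) (by omega),
      hT (i.1 + 1) (by omega) (by omega), hT (i.1 + 2) (by omega) (by omega)]
    push_cast
    split_ifs <;> first | omega | rfl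
  have hZ : ∀ (i : Fin n) (j : Fin (n - 2)), Zmat2 θ n i j = Zz T i.1 j.1 := by
    intro i j
    have hj := j.2
    simp only [Zmat2, Matrix.of_apply, Zz]
    rw [hT (j.1 + 2) (by omega) (by omega), hT (j.1 + 3) (by omega) (by omega),
      hT (j.1 + 4) (by omega) (by omega)]
    push_cast
    split_ifs <;> first | omega | rfl
  have hDD : ∀ (j : Fin (n - 2)) (k : Fin n),
      (Dmat θ 3 (n - 2) (n - 1) * Dmat θ 2 (n - 1) n) j k = DDz T j.1 k.1 := by
    intro j k
    have hj := j.2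
    rw [Matrix.mul_apply]
    simp only [hD2, hD3]
    have hz : ∀ l : ℤ, l ≠ j.1 → l ≠ j.1 + 1 → Dz T 3 j.1 l * Dz T 2 l k.1 = 0 := by
      intro l h1 h2
      simp [Dz, h1, h2]
    rw [sum3 (n - 1) (fun l => Dz T 3 j.1 l * Dz T 2 l k.1) j.1 (fun l _ h h' => hz l h h')
      (fun l hl => hz l (by omega) (by omega)) (fun l hl => hz l (by omega) (by omega))]
    simp only [DDz]
    rw [hz ((j.1 : ℤ) - 1) (by omega) (by omega), zero_add]
  ext i k
  have hi := i.2
  rw [Matrix.sub_apply, Matrix.mul_apply, Matrix.mul_apply, Matrix.one_apply]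
  simp only [hG, hS, hZ, hDD]
  rw [sum3 n (fun l => Gz T i.1 l * Sz T l k.1) i.1, sum3 (n - 2) (fun l => Zz T i.1 l * DDz T l k.1) (i.1 - 1)]
  · rw [← mainz T hmono h2]
    simp [Fin.ext_iff]
  · intro l h1 h2 h3
    have e1 : (i.1 : ℤ) ≠ l := by omega
    have e2 : (i.1 : ℤ) ≠ l + 1 := by omega
    have e3 : (i.1 : ℤ) ≠ l + 2 := by omega
    simp [Zz, e1, e2, e3]
  · intro l hl
    by_cases hc : l = -1
    · subst hc
      simp [Zz, hA]
    · by_cases hc : l = -2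
      · subst hc
        simp [Zz, hA]
      · have e1 : (i.1 : ℤ) ≠ l := by omega
        have e2 : (i.1 : ℤ) ≠ l + 1 := by omega
        have e3 : (i.1 : ℤ) ≠ l + 2 := by omega
        simp [Zz, e1, e2, e3]
  · intro l hl
    by_cases hc : l = n - 2
    · have e3 : l + 3 = n + 1 := by omega
      have e4 : l + 4 = n + 2 := by omega
      simp [Zz, e3, e4, hB]
    · by_cases hc : l = n - 1
      · have e3 : l + 2 = n + 1 := by omega
        have e4 : l + 3 = n + 2 := by omega
        simp [Zz, e3, e4, hB]
      · have e1 : (i.1 : ℤ) ≠ l := by omega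
        have e2 : (i.1 : ℤ) ≠ l + 1 := by omega
        have e3 : (i.1 : ℤ) ≠ l + 2 := by omega
        simp [Zz, e1, e2, e3]
  · intro l h1 h2 h3
    have e1 : (i.1 : ℤ) ≠ l + 1 := by omega
    simp [Gz, e1, h2, h3]
  · intro l hl
    have e1 : l ≠ i.1 := by omega
    have e2 : l ≠ i.1 + 1 := by omega
    by_cases hc : (i.1 : ℤ) = l + 1
    · have : (i.1 : ℤ) = 0 := by omega
      have f1 : l ≠ 0 := by omega
      have f2 : l ≠ 1 := by omega
      simp [Gz, f1, f2, this, hA]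
    · simp [Gz, e1, e2, hc]
  · intro l hl
    have e1 : l ≠ i.1 := by omega
    have e2 : (i.1 : ℤ) ≠ l + 1 := by omega
    by_cases hc : l = i.1 + 1
    · have e3 : (i.1 : ℤ) + 3 = n + 2 := by omega
      have e4 : (i.1 : ℤ) + 2 = n + 1 := by omega
      simp [Gz, e1, e2, e3, e4, hB]
    · simp [Gz, e1, e2, hc]
end

section
/- (Case m = 2.) Let 3 ≤ ℓ_1 < ⋯ < ℓ_r ≤ n be indices of interior knots of Θ. Let A = [N_{4,k}(θ_{ℓ_j})]_{1≤j≤r, 1≤k≤n−2} ∈ ℝ^{r×(n−2)} and let B ∈ ℝ^{r×(n−2)} be the matrix whose j-th row is κ_{ℓ_j} e_{ℓ_j−2}^T, where κ_ℓ = (θ_ℓ−θ_{ℓ−1})²(θ_{ℓ+1}−θ_ℓ)² / (18(θ_{ℓ+1}−θ_{ℓ−1})) and e_k is the k-th canonical unit vector of ℝ^{n−2}. Then for every matrix U_2 ∈ ℝ^{(n−2)×(n−2)} with A U_2 = B, the kernel L(x,y) = Φ_2(y) (S + D_2^T D_3^T U_2 D_3 D_2) Φ_2(x)^T satisfies ∫_a^b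 f(y) L(x,y) dy = f(x) for all x ∈ [a,b), both for every polynomial f of degree at most 1 and for each truncated power f(x) = (θ_{ℓ_j} − x)_+ := max(θ_{ℓ_j} − x, 0), 1 ≤ j ≤ r. -/
open scoped BigOperators
open MeasureTheory Matrix

section helpers
variable {a b : ℝ} {n : ℕ} {θ : ℕ → ℝ}

theorem kn_mono (h12 : θ 1 = θ 2) (hn12 : θ (n + 1) = θ (n + 2))
    (hstrict : ∀ i, 2 ≤ i → i ≤ n → θ i < θ (i + 1)) (i j : ℕ) (hi : 1 ≤ i) (hij : i ≤ j)
    (hj : j ≤ n + 2) : θ i ≤ θ j := by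
  induction j, hij using Nat.le_induction with
  | base => exact le_rfl
  | succ m hm ih =>
    refine (ih (by omega)).trans ?_
    rcases Nat.lt_or_ge m 2 with h | h
    · obtain rfl : m = 1 := by omega
      exact h12.le
    · rcases Nat.lt_or_ge n m with h' | h'
      · obtain rfl : m = n + 1 := by omega
        exact hn12.le
      · exact (hstrict m h h').le

theorem kn_strict (hn : 2 ≤ n) (h12 : θ 1 = θ 2) (hn12 : θ (n + 1) = θ (n + 2))
    (hstrict : ∀ i, 2 ≤ i → i ≤ n → θ i < θ (i + 1)) (i j : ℕ) (hi : 1 ≤ i) (hij : i < j)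
    (hj : j ≤ n + 2) (hj3 : 3 ≤ j) (hin : i ≤ n) : θ i < θ j := by
  have hm := kn_mono h12 hn12 hstrict
  rcases Nat.lt_or_ge i 2 with h | h
  · obtain rfl : i = 1 := by omega
    calc θ 1 ≤ θ 2 := h12.le
        _ < θ 3 := hstrict 2 le_rfl hn
        _ ≤ θ j := hm 3 j (by omega) hj3 hj
  · exact (hstrict i h hin).trans_le (hm (i+1) j (by omega) hij hj)

theorem int_ite_s8 (u v : ℝ) (hau : a ≤ u) (huv : u ≤ v) (hvb : v ≤ b) (g : ℝ → ℝ)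
    (hg : Continuous g) :
    IntervalIntegrable (fun y => if u ≤ y ∧ y < v then g y else 0) volume a b ∧
    (∫ y in a..b, (if u ≤ y ∧ y < v then g y else 0)) = ∫ y in u..v, g y := by
  have e : (fun y => if u ≤ y ∧ y < v then g y else 0) = (Set.Ico u v).indicator g := by
    ext y
    simp [Set.indicator, Set.mem_Ico]
  have hii : Integrable ((Set.Ico u v).indicator g) volume := by
    rw [integrable_indicator_iff measurableSet_Ico]
    exact (hg.continuousOn.integrableOn_compact isCompact_Icc).mono_set Set.Ico_subset_Icc_self
  rw [e]
  refine ⟨hii.intervalIntegrable, ?_⟩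
  rw [intervalIntegral.integral_of_le (hau.trans (huv.trans hvb)),
    intervalIntegral.integral_of_le huv, ← integral_Icc_eq_integral_Ioc,
    setIntegral_indicator measurableSet_Ico, ← integral_Ico_eq_integral_Ioc]
  congr 2
  rw [Set.inter_eq_right]
  intro y hy
  exact ⟨hau.trans hy.1, hy.2.le.trans hvb⟩

theorem int_up (u v p s : ℝ) (huv : u < v) (F : ℝ → ℝ) 
    (hF : ∀ y ∈ Set.Icc u v, F y = p + (s - p) * ((y - u) / (v - u))) :
    (∫ y in u..v, F y * ((y - u) / (v - u))) = (v - u) * (p + 2 * s) / 6 ∧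
    (∫ y in u..v, F y * (1 - (y - u) / (v - u))) = (v - u) * (2 * p + s) / 6 := by
  have hne : v - u ≠ 0 := sub_ne_zero.mpr huv.ne'
  constructor
  · have h1 : (∫ y in u..v, F y * ((y - u) / (v - u))) =
        ∫ y in u..v, (p + (s - p) * ((y - u) / (v - u))) * ((y - u) / (v - u)) := by
      apply intervalIntegral.integral_congr
      intro y hy
      rw [Set.uIcc_of_le huv.le] at hy
      simp only [hF y hy]
    rw [h1, intervalIntegral.integral_eq_sub_of_hasDerivAt
      (f := fun y => (p * (y - u)^2 / 2 + (s - p) * (y - u)^3 / (3 * (v-u))) / (v - u))]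
    · field_simp; ring
    · intro y _
      have h0 : HasDerivAt (fun y : ℝ => y - u) 1 y := (hasDerivAt_id y).sub_const u
      exact (((((h0.pow 2).const_mul p).div_const 2).add
        (((h0.pow 3).const_mul (s-p)).div_const (3 * (v-u)))).div_const (v-u)).congr_deriv
        (by norm_num; field_simp)
    · apply Continuous.intervalIntegrable; fun_prop
  · have h1 : (∫ y in u..v, F y * (1 - (y - u) / (v - u))) =
        ∫ y in u..v, (p + (s - p) * ((y - u) / (v - u))) * (1 - (y - u) / (v - u)) := by
      apply intervalIntegral.integral_congr
      intro y hy
      rw [Set.uIcc_of_le huv.le] at hy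
      simp only [hF y hy]
    rw [h1, intervalIntegral.integral_eq_sub_of_hasDerivAt
      (f := fun y => p * (y - u) + (s - 2*p) * (y - u)^2 / (2 * (v-u))
         - (s - p) * (y - u)^3 / (3 * (v-u)^2))]
    · field_simp; ring
    · intro y _
      have h0 : HasDerivAt (fun y : ℝ => y - u) 1 y := (hasDerivAt_id y).sub_const u
      exact (((h0.const_mul p).add (((h0.pow 2).const_mul (s-2*p)).div_const (2 * (v-u)))).sub
        (((h0.pow 3).const_mul (s-p)).div_const (3 * (v-u)^2))).congr_deriv
        (by norm_num; field_simp; ring)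
    · apply Continuous.intervalIntegrable; fun_prop

/-- moments from nodal values -/
noncomputable def gMom (θ c : ℕ → ℝ) (k : ℕ) : ℝ :=
  (θ (k + 1) - θ k) * (c k + 2 * c (k + 1)) / 6
    + (θ (k + 2) - θ (k + 1)) * (2 * c (k + 1) + c (k + 2)) / 6

theorem N2_eq (k : ℕ) (y : ℝ) : Nspl θ 2 k y =
    (if θ k ≤ y ∧ y < θ (k + 1) then (y - θ k) / (θ (k + 1) - θ k) else 0) +
    (if θ (k + 1) ≤ y ∧ y < θ (k + 2) then
      1 - (y - θ (k + 1)) / (θ (k + 2) - θ (k + 1)) else 0) := by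
  rw [show (2 : ℕ) = 0 + 2 from rfl]
  simp only [Nspl, omegaB, zero_add]
  rw [show k + 1 + 1 = k + 2 from rfl]
  congr 1
  · by_cases h : θ k ≤ y ∧ y < θ (k + 1)
    · have := h.1.trans_lt h.2
      simp [h, this]
    · simp [h]
  · by_cases h : θ (k + 1) ≤ y ∧ y < θ (k + 2)
    · have := h.1.trans_lt h.2
      simp [h, this]
    · simp [h]

theorem N2_int (h1 : θ 1 = a) (hn2 : θ (n + 2) = b) 
    (hm : ∀ i j, 1 ≤ i → i ≤ j → j ≤ n + 2 → θ i ≤ θ j) (F : ℝ → ℝ) (hF : Continuous F)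
    (hFa : ∀ i, 1 ≤ i → i ≤ n + 1 → ∀ y ∈ Set.Icc (θ i) (θ (i + 1)),
      F y = F (θ i) + (F (θ (i + 1)) - F (θ i)) * ((y - θ i) / (θ (i + 1) - θ i)))
    (k : ℕ) (hk : 1 ≤ k) (hkn : k ≤ n) :
    IntervalIntegrable (fun y => F y * Nspl θ 2 k y) volume a b ∧
    (∫ y in a..b, F y * Nspl θ 2 k y) = gMom θ (fun i => F (θ i)) k := by
  have e : (fun y => F y * Nspl θ 2 k y) = fun y =>
     (if θ k ≤ y ∧ y < θ (k + 1) then F y * ((y - θ k) / (θ (k + 1) - θ k)) else 0) +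
    (if θ (k + 1) ≤ y ∧ y < θ (k + 2) then
      F y * (1 - (y - θ (k + 1)) / (θ (k + 2) - θ (k + 1))) else 0) := by
    ext y
    rw [N2_eq, mul_add, mul_ite, mul_ite, mul_zero]
  have A1 := int_ite_s8 (a := a) (b := b) (θ k) (θ (k+1)) (h1 ▸ hm 1 k le_rfl hk (by omega))
    (hm k (k+1) hk (by omega) (by omega)) (hn2 ▸ hm (k+1) (n+2) (by omega) (by omega) le_rfl)
    (fun y => F y * ((y - θ k) / (θ (k + 1) - θ k))) (by fun_prop)
  have A2 := int_ite_s8 (a := a) (b := b) (θ (k+1)) (θ (k+2)) (h1 ▸ hm 1 (k+1) le_rfl (by omega) (by omega))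
    (hm (k+1) (k+2) (by omega) (by omega) (by omega))
    (hn2 ▸ hm (k+2) (n+2) (by omega) (by omega) le_rfl)
    (fun y => F y * (1 - (y - θ (k + 1)) / (θ (k + 2) - θ (k + 1)))) (by fun_prop)
  rw [e]
  refine ⟨A1.1.add A2.1, ?_⟩
  rw [intervalIntegral.integral_add A1.1 A2.1, A1.2, A2.2, gMom]
  congr 1
  · rcases (hm k (k+1) hk (by omega) (by omega)).eq_or_lt with h | h
    · simp [h]
    · exact (int_up _ _ _ _ h F (hFa k hk (by omega))).1
  · rcases (hm (k+1) (k+2) (by omega) (by omega) (by omega)).eq_or_lt with h | h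
    · simp [h]
    · exact (int_up _ _ _ _ h F (hFa (k+1) (by omega) (by omega))).2

theorem N2_repro (h2 : θ 2 = a) (hn1 : θ (n + 1) = b) 
    (hm : ∀ i j, 1 ≤ i → i ≤ j → j ≤ n + 2 → θ i ≤ θ j) (F : ℝ → ℝ)
    (hFa : ∀ i, 1 ≤ i → i ≤ n + 1 → ∀ y ∈ Set.Icc (θ i) (θ (i + 1)),
      F y = F (θ i) + (F (θ (i + 1)) - F (θ i)) * ((y - θ i) / (θ (i + 1) - θ i)))
    (x : ℝ) (hx : x ∈ Set.Ico a b) :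
    ∑ k : Fin n, F (θ (k.1 + 2)) * Nspl θ 2 (k.1 + 1) x = F x := by
  have hex : ∃ i, x < θ (i + 1) ∧ 2 ≤ i ∧ i ≤ n ∧ θ i ≤ x := by
    have hex0 : ∃ i, x < θ (i + 2) := ⟨n - 1, by
      rcases Nat.eq_zero_or_pos n with h | h
      · subst h
        have := hm 1 2 le_rfl (by omega) le_rfl
        simp at hn1
        exfalso
        obtain ⟨h3, h4⟩ := hx
        rw [← hn1] at h4
        linarith
      · rw [show n - 1 + 2 = n + 1 by omega, hn1]; exact hx.2⟩
    classical
    have hs := Nat.find_spec hex0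
    have hmin := fun m => Nat.find_min (m := m) hex0
    have hle : Nat.find hex0 ≤ n - 1 := Nat.find_min' hex0 (by
      rcases Nat.eq_zero_or_pos n with h | h
      · subst h
        have := hm 1 2 le_rfl (by omega) le_rfl
        simp at hn1
        exfalso
        obtain ⟨h3, h4⟩ := hx
        rw [← hn1] at h4
        linarith
      · rw [show n - 1 + 2 = n + 1 by omega, hn1]; exact hx.2)
    generalize Nat.find hex0 = i at *
    rcases Nat.eq_zero_or_pos i with h | h
    · subst h
      simp only [zero_add, h2] at hs
      exact absurd hx.1 (not_le.mpr hs)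
    · refine ⟨i + 1, hs, by omega, by omega, ?_⟩
      have := hmin (i - 1) (by omega)
      rw [show i - 1 + 2 = i + 1 by omega] at this
      exact not_lt.mp this
  obtain ⟨i, hi1, hi2, hin, hi3⟩ := hex
  have hN : ∀ k, 1 ≤ k → k ≤ n → Nspl θ 2 k x =
      (if k = i then (x - θ i) / (θ (i + 1) - θ i) else 0) +
      (if k + 1 = i then 1 - (x - θ i) / (θ (i + 1) - θ i) else 0) := by
    intro k hk hkn
    have key : ∀ j, 1 ≤ j → j ≤ n + 1 → ((θ j ≤ x ∧ x < θ (j + 1)) ↔ j = i) := by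
      intro j hj hjn
      constructor
      · rintro ⟨h3, h4⟩
        by_contra hne
        rcases lt_or_gt_of_ne hne with h | h
        · have := hm (j+1) i (by omega) (by omega) (by omega)
          linarith
        · have := hm (i+1) j (by omega) (by omega) (by omega)
          linarith
      · rintro rfl; exact ⟨hi3, hi1⟩
    rw [N2_eq]
    have k1 := key k hk (by omega)
    have k2 := key (k+1) (by omega) (by omega)
    rw [show k + 1 + 1 = k + 2 from rfl] at k2
    simp only [k1, k2]
    congr 1
    · split_ifs with h
      · subst h; rfl
      · rfl
    · split_ifs with h
      · subst h; rfl
      · rfl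
  have hsum : ∑ k : Fin n, F (θ (k.1 + 2)) * Nspl θ 2 (k.1 + 1) x =
      ∑ k ∈ Finset.range n, F (θ (k + 2)) * Nspl θ 2 (k + 1) x :=
    Fin.sum_univ_eq_sum_range (fun k => F (θ (k + 2)) * Nspl θ 2 (k + 1) x) n
  obtain ⟨m, rfl⟩ : ∃ m, i = m + 2 := ⟨i - 2, by omega⟩
  have : ∀ k ∈ Finset.range n, F (θ (k + 2)) * Nspl θ 2 (k + 1) x = 
      (if k = m + 1 then F (θ (k+2)) * ((x - θ (m + 2)) / (θ (m + 2 + 1) - θ (m + 2))) else 0)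
      + (if k = m then F (θ (k+2)) * (1 - (x - θ (m + 2)) / (θ (m + 2 + 1) - θ (m + 2))) else 0) := by
    intro k hk
    rw [Finset.mem_range] at hk
    rw [hN (k+1) (by omega) (by omega)]
    simp only [Nat.add_right_cancel_iff, show (k + 1 = m + 2) = (k = m + 1) by simp]
    rw [mul_add, mul_ite, mul_ite, mul_zero]
  rw [hsum, Finset.sum_congr rfl this, Finset.sum_add_distrib, Finset.sum_ite_eq', Finset.sum_ite_eq',
    if_pos (by simp; omega), if_pos (by simp; omega), hFa (m+2) (by omega) (by omega) x ⟨hi3, hi1.le⟩]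
  rw [show m + 1 + 2 = m + 2 + 1 from rfl]
  ring

theorem sum_fin_range (N : ℕ) (u : Fin N → ℝ) (f : ℕ → ℝ) (h : ∀ j : Fin N, u j = f j.1) :
    ∑ j : Fin N, u j = ∑ j ∈ Finset.range N, f j := by
  rw [Finset.sum_congr rfl (fun j _ => h j), Fin.sum_univ_eq_sum_range]

theorem Dmat_mulVec (ord p q : ℕ) (h : p + 1 = q) (g : ℕ → ℝ) (k : Fin p) :
    (Dmat θ ord p q *ᵥ fun j => g j.1) k =
      (ord : ℝ) / (θ (k.1 + 1 + ord) - θ (k.1 + 1)) * g k.1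
      - (ord : ℝ) / (θ (k.1 + 2 + ord) - θ (k.1 + 2)) * g (k.1 + 1) := by
  obtain ⟨f, hf⟩ : ∃ f : ℕ → ℝ, f =
      (fun j : ℕ => (if j = k.1 then (ord : ℝ) / (θ (k.1 + 1 + ord) - θ (k.1 + 1)) * g j else 0)
      + (if j = k.1 + 1 then -((ord : ℝ) / (θ (k.1 + 2 + ord) - θ (k.1 + 2))) * g j else 0)) := ⟨_, rfl⟩
  have e : ∀ j : Fin q, Dmat θ ord p q k j * g j.1 = f j.1 := by
    intro j
    rw [hf]
    simp only [Dmat, Matrix.of_apply]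
    split_ifs with h1 h2 <;> first | omega | simp
  have hk := k.2
  rw [Matrix.mulVec, dotProduct, sum_fin_range _ _ f e, hf,
    Finset.sum_add_distrib, Finset.sum_ite_eq', Finset.sum_ite_eq',
    if_pos (by simp; omega), if_pos (by simp; omega)]
  ring

/-- normalized moments -/
noncomputable def qMom (θ g : ℕ → ℝ) (k : ℕ) : ℝ := 2 * g k / (θ (k + 2) - θ k)

theorem S2_vecMul (g : ℕ → ℝ) (hw : ∀ k, 1 ≤ k → k ≤ n → θ (k + 2) - θ k ≠ 0) (k : Fin n) :
    ∑ i : Fin n, g (i.1 + 1) * S2 θ n i k =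
      qMom θ g (k.1 + 1) + 1 / (θ (k.1 + 3) - θ (k.1 + 1)) *
       (alpha2 θ n k.1 * (qMom θ g (k.1 + 1) - qMom θ g k.1)
        - alpha2 θ n (k.1 + 1) * (qMom θ g (k.1 + 2) - qMom θ g (k.1 + 1))) := by
  obtain ⟨k, hk⟩ := k
  obtain ⟨f, hf⟩ : ∃ f : ℕ → ℝ, f =
      (fun i : ℕ => (if i = k then g (k + 1) * (2 / (θ (k + 3) - θ (k + 1))
        + 2 * (alpha2 θ n k + alpha2 θ n (k + 1)) / (θ (k + 3) - θ (k + 1)) ^ 2) else 0)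
        + (if i = k - 1 then (if 1 ≤ k then g k * beta2 θ k else 0) else 0)
        + (if i = k + 1 then g (k + 2) * beta2 θ (k + 1) else 0)) := ⟨_, rfl⟩
  have e : ∀ i : Fin n, g (i.1 + 1) * S2 θ n i ⟨k, hk⟩ = f i.1 := by
    rw [hf]
    rintro ⟨i, hi⟩
    simp only [S2, Matrix.of_apply]
    rcases lt_trichotomy i k with h | h | h
    · by_cases h2 : k = i + 1
      · subst h2
        have : i ≠ i + 1 + 1 := by omega
        simp [this]
      · rw [if_neg (by omega), if_neg h2, if_neg (by omega), if_neg (by omega), if_neg (by omega),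
          if_neg (by omega)]
        simp
    · subst h
      rcases Nat.eq_zero_or_pos i with h | h
      · subst h; simp
      · rw [if_pos rfl, if_pos rfl, if_neg (by omega), if_neg (by omega)]
        simp
    · by_cases h2 : i = k + 1
      · subst h2
        have : k + 1 ≠ k - 1 := by omega
        have h3 : k ≠ k + 1 + 1 := by omega
        simp [this, h3]
      · rw [if_neg (by omega), if_neg (by omega), if_neg (by omega), if_neg (by omega),
          if_neg (by omega), if_neg (by omega)]
        simp
  have hb : ∀ j, 1 ≤ j → j ≤ n - 1 → beta2 θ j =
      - (2 / (θ (j + 2) - θ j)) * alpha2 θ n j / (θ (j + 3) - θ (j + 1)) := by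
    intro j hj hjn
    rw [alpha2, if_pos ⟨hj, hjn⟩, beta2, neg_div, neg_mul, neg_div, div_mul_div_comm, div_div]
  rw [sum_fin_range _ _ f e, hf,
    Finset.sum_add_distrib, Finset.sum_add_distrib, Finset.sum_ite_eq', Finset.sum_ite_eq',
    Finset.sum_ite_eq', if_pos (by simpa using hk), if_pos (by simp; omega)]
  have w0 := hw (k+1) (by omega) (by omega)
  rw [show k + 1 + 2 = k + 3 from rfl] at w0
  have c1 : (if 1 ≤ k then g k * beta2 θ k else 0) =
      - (1 / (θ (k + 3) - θ (k + 1)) * (alpha2 θ n k * qMom θ g k)) := by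
    split_ifs with h
    · rw [hb k h (by omega), qMom]; ring
    · simp [alpha2, h]
  have c2 : (if k + 1 ∈ Finset.range n then g (k + 2) * beta2 θ (k + 1) else 0) =
      - (1 / (θ (k + 3) - θ (k + 1)) * (alpha2 θ n (k + 1) * qMom θ g (k + 2))) := by
    simp only [Finset.mem_range]
    split_ifs with h
    · rw [hb (k+1) (by omega) (by omega), qMom]
      rw [show k + 1 + 2 = k + 3 from rfl, show k + 1 + 3 = k + 4 from rfl,
        show k + 2 + 2 = k + 4 from rfl, show k + 1 + 1 = k + 2 from rfl]
      ring
    · have : ¬ (k + 1 ≤ n - 1) := by omega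
      simp [alpha2, this]
  rw [c1, c2]
  have : qMom θ g (k + 1) = 2 * g (k + 1) / (θ (k + 3) - θ (k + 1)) := rfl
  rw [this]
  field_simp
  ring

theorem N1_knot (hm : ∀ i j, 1 ≤ i → i ≤ j → j ≤ n + 2 → θ i ≤ θ j)
    (hstrict : ∀ i, 2 ≤ i → i ≤ n → θ i < θ (i + 1)) (l : ℕ) (hl : 3 ≤ l) (hln : l ≤ n)
    (i : ℕ) (hi : 1 ≤ i) (hin : i ≤ n + 1) : Nspl θ 1 i (θ l) = if i = l then 1 else 0 := by
  simp only [Nspl]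
  congr 1
  apply propext
  constructor
  · rintro ⟨h1, h2⟩
    by_contra hne
    rcases lt_or_gt_of_ne hne with h | h
    · have := hm (i+1) l (by omega) (by omega) (by omega)
      linarith
    · have := hm (l+1) i (by omega) (by omega) (by omega)
      linarith [hstrict l (by omega) hln]
  · rintro rfl; exact ⟨le_rfl, hstrict i (by omega) hln⟩


theorem N_step (j k : ℕ) (x : ℝ) : Nspl θ (j + 2) k x =
    omegaB θ (j + 1) k x * Nspl θ (j + 1) k x
        + (1 - omegaB θ (j + 1) (k + 1) x) * Nspl θ (j + 1) (k + 1) x := by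
  simp only [Nspl]

theorem omega_pos (j k : ℕ) (x : ℝ) (h : θ k < θ (k + j)) :
    omegaB θ j k x = (x - θ k) / (θ (k + j) - θ k) := by
  rw [omegaB, if_pos h]

theorem omega_self (j k : ℕ) : omegaB θ j k (θ k) = 0 := by
  rw [omegaB]; simp

theorem N4_expand (k : ℕ) (x : ℝ) : Nspl θ 4 k x =
    omegaB θ 3 k x * (omegaB θ 2 k x * (omegaB θ 1 k x * Nspl θ 1 k x
        + (1 - omegaB θ 1 (k + 1) x) * Nspl θ 1 (k + 1) x)
      + (1 - omegaB θ 2 (k + 1) x) * (omegaB θ 1 (k + 1) x * Nspl θ 1 (k + 1) x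
        + (1 - omegaB θ 1 (k + 2) x) * Nspl θ 1 (k + 2) x))
    + (1 - omegaB θ 3 (k + 1) x) * (omegaB θ 2 (k + 1) x * (omegaB θ 1 (k + 1) x * Nspl θ 1 (k + 1) x
        + (1 - omegaB θ 1 (k + 2) x) * Nspl θ 1 (k + 2) x)
      + (1 - omegaB θ 2 (k + 2) x) * (omegaB θ 1 (k + 2) x * Nspl θ 1 (k + 2) x
        + (1 - omegaB θ 1 (k + 3) x) * Nspl θ 1 (k + 3) x)) := by
  rw [N_step 2, N_step 1, N_step 1, N_step 0, N_step 0, N_step 0]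

theorem q_lin (c : ℕ → ℝ) (p s : ℝ) (k : ℕ) (hw : θ (k + 2) - θ k ≠ 0)
    (h0 : c k = p + s * θ k) (h1 : c (k + 1) = p + s * θ (k + 1))
    (h2 : c (k + 2) = p + s * θ (k + 2)) :
    qMom θ (gMom θ c) k = p + s * (θ k + θ (k + 1) + θ (k + 2)) / 3 := by
  rw [qMom, gMom, h0, h1, h2, div_eq_iff hw]
  ring

theorem E_lin (h12 : θ 1 = θ 2) (hn12 : θ (n + 1) = θ (n + 2)) (q : ℕ → ℝ) (p s : ℝ) (j : ℕ)
    (hj : j ≤ n)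
    (hw : 1 ≤ j → j ≤ n - 1 → θ (j + 3) - θ j ≠ 0)
    (h0 : 1 ≤ j → q j = p + s * (θ j + θ (j + 1) + θ (j + 2)) / 3)
    (h1 : 1 ≤ j → j ≤ n - 1 → q (j + 1) = p + s * (θ (j + 1) + θ (j + 2) + θ (j + 3)) / 3) :
    alpha2 θ n j * (q (j + 1) - q j) = s * (θ (j + 2) - θ (j + 1)) ^ 2 / 3 := by
  rw [alpha2]
  split_ifs with h
  · have := hw h.1 h.2
    rw [h0 h.1, h1 h.1 h.2]
    field_simp
    ring
  · rcases Nat.eq_zero_or_pos j with h' | h'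
    · subst h'; simp [h12]
    · obtain rfl : j = n := by omega
      simp [hn12]

theorem S_lin_alg (p s t0 t1 t2 : ℝ) (hw : t2 - t0 ≠ 0) :
    p + s * (t0 + t1 + t2) / 3 + 1 / (t2 - t0) * (s * (t1 - t0) ^ 2 / 3 - s * (t2 - t1) ^ 2 / 3)
      = p + s * t1 := by
  field_simp
  ring

theorem fin_gen (h1 : θ 1 = a) (h2 : θ 2 = a) (hn1 : θ (n + 1) = b) (hn2 : θ (n + 2) = b)
    (hm : ∀ i j, 1 ≤ i → i ≤ j → j ≤ n + 2 → θ i ≤ θ j) (F : ℝ → ℝ) (hF : Continuous F)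
    (hFa : ∀ i, 1 ≤ i → i ≤ n + 1 → ∀ y ∈ Set.Icc (θ i) (θ (i + 1)),
      F y = F (θ i) + (F (θ (i + 1)) - F (θ i)) * ((y - θ i) / (θ (i + 1) - θ i)))
    (M : Matrix (Fin n) (Fin n) ℝ)
    (hM : ∀ k : Fin n, ∑ i : Fin n, gMom θ (fun i => F (θ i)) (i.1 + 1) * M i k = F (θ (k.1 + 2)))
    (x : ℝ) (hx : x ∈ Set.Ico a b) :
    (∫ y in a..b, F y * ∑ i : Fin n, ∑ k : Fin n,
      M i k * Nspl θ 2 (i.1 + 1) y * Nspl θ 2 (k.1 + 1) x) = F x := by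
  have e : (fun y => F y * ∑ i : Fin n, ∑ k : Fin n,
      M i k * Nspl θ 2 (i.1 + 1) y * Nspl θ 2 (k.1 + 1) x) = fun y =>
      ∑ i : Fin n, (∑ k : Fin n, M i k * Nspl θ 2 (k.1 + 1) x) * (F y * Nspl θ 2 (i.1 + 1) y) := by
    ext y
    rw [Finset.mul_sum]
    refine Finset.sum_congr rfl fun i _ => ?_
    rw [Finset.mul_sum, Finset.sum_mul]
    refine Finset.sum_congr rfl fun k _ => ?_
    ring
  have hI := fun i : Fin n => N2_int h1 hn2 hm F hF hFa (i.1 + 1) (by omega) (by omega)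
  rw [e, intervalIntegral.integral_finsetSum (fun i _ => (hI i).1.const_mul _)]
  simp only [intervalIntegral.integral_const_mul, (hI _).2]
  rw [← N2_repro h2 hn1 hm F hFa x hx]
  simp only [← hM, Finset.sum_mul]
  rw [Finset.sum_comm]
  refine Finset.sum_congr rfl fun i _ => Finset.sum_congr rfl fun k _ => ?_
  ring

theorem M_split (g : Fin n → ℝ) (S : Matrix (Fin n) (Fin n) ℝ) {N : ℕ} (D : Matrix (Fin N) (Fin n) ℝ)
    (U : Matrix (Fin N) (Fin N) ℝ) (k : Fin n) :
    ∑ i, g i * (S + Dᵀ * U * D) i k = ∑ i, g i * S i k + (((D *ᵥ g) ᵥ* U) ᵥ* D) k := by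
  rw [← Matrix.vecMul_transpose, Matrix.vecMul_vecMul, Matrix.vecMul_vecMul, Matrix.mul_assoc]
  simp only [Matrix.vecMul, dotProduct, Matrix.add_apply, mul_add, Finset.sum_add_distrib]

theorem D_mulVec (hn : 2 ≤ n) (g : ℕ → ℝ) (k : Fin (n - 2)) :
    ((Dmat θ 3 (n - 2) (n - 1) * Dmat θ 2 (n - 1) n) *ᵥ fun i : Fin n => g (i.1 + 1)) k =
      3 / (θ (k.1 + 4) - θ (k.1 + 1)) * (qMom θ g (k.1 + 1) - qMom θ g (k.1 + 2))
      - 3 / (θ (k.1 + 5) - θ (k.1 + 2)) * (qMom θ g (k.1 + 2) - qMom θ g (k.1 + 3)) := by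
  rw [← Matrix.mulVec_mulVec]
  have e : (Dmat θ 2 (n - 1) n *ᵥ fun i : Fin n => g (i.1 + 1)) =
      fun j : Fin (n - 1) => (fun j : ℕ => qMom θ g (j + 1) - qMom θ g (j + 2)) j.1 := by
    ext j
    rw [Dmat_mulVec 2 (n-1) n (by omega) (fun i => g (i + 1))]
    simp only [qMom]
    push_cast
    rw [show j.1 + 1 + 2 = j.1 + 3 from rfl, show j.1 + 2 + 2 = j.1 + 4 from rfl,
      show j.1 + 1 + 1 = j.1 + 2 from rfl]
    ring
  rw [e, Dmat_mulVec 3 (n-2) (n-1) (by omega) (fun j : ℕ => qMom θ g (j + 1) - qMom θ g (j + 2))]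
  push_cast
  rfl

theorem D_entry (hn : 2 ≤ n) (m : Fin (n - 2)) (k : Fin n) :
    (Dmat θ 3 (n - 2) (n - 1) * Dmat θ 2 (n - 1) n) m k =
      3 / (θ (m.1 + 4) - θ (m.1 + 1)) * (if k.1 = m.1 then 2 / (θ (m.1 + 3) - θ (m.1 + 1)) else
          if k.1 = m.1 + 1 then -(2 / (θ (m.1 + 4) - θ (m.1 + 2))) else 0)
      - 3 / (θ (m.1 + 5) - θ (m.1 + 2)) * (if k.1 = m.1 + 1 then 2 / (θ (m.1 + 4) - θ (m.1 + 2)) else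
          if k.1 = m.1 + 2 then -(2 / (θ (m.1 + 5) - θ (m.1 + 3))) else 0) := by
  have := Dmat_mulVec (θ := θ) 3 (n-2) (n-1) (by omega) (fun j : ℕ =>
    (if k.1 = j then 2 / (θ (j + 3) - θ (j + 1)) else
          if k.1 = j + 1 then -(2 / (θ (j + 4) - θ (j + 2))) else 0)) m
  push_cast at this
  exact this

theorem stmt_poly (h1 : θ 1 = a) (h2 : θ 2 = a) (hn1 : θ (n + 1) = b) (hn2 : θ (n + 2) = b)
    (hn : 2 ≤ n) (hstrict : ∀ i, 2 ≤ i → i ≤ n → θ i < θ (i + 1))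
    (U : Matrix (Fin (n - 2)) (Fin (n - 2)) ℝ) (p s : ℝ) (k : Fin n) :
    ∑ i : Fin n, gMom θ (fun i => p + s * θ i) (i.1 + 1) *
      (S2 θ n + (Dmat θ 3 (n - 2) (n - 1) * Dmat θ 2 (n - 1) n)ᵀ * U *
          (Dmat θ 3 (n - 2) (n - 1) * Dmat θ 2 (n - 1) n)) i k = p + s * θ (k.1 + 2) := by
  have h12 : θ 1 = θ 2 := by rw [h1, h2]
  have hn12 : θ (n+1) = θ (n+2) := by rw [hn1, hn2]
  have hs := kn_strict hn h12 hn12 hstrict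
  have hw : ∀ k, 1 ≤ k → k ≤ n → θ (k + 2) - θ k ≠ 0 := fun k hk hkn =>
    sub_ne_zero.mpr (hs k (k+2) hk (by omega) (by omega) (by omega) hkn).ne'
  have hw3 : ∀ k, 1 ≤ k → k ≤ n - 1 → θ (k + 3) - θ k ≠ 0 := fun k hk hkn =>
    sub_ne_zero.mpr (hs k (k+3) hk (by omega) (by omega) (by omega) (by omega)).ne'
  have hq : ∀ k, 1 ≤ k → k ≤ n → qMom θ (gMom θ fun i => p + s * θ i) k =
      p + s * (θ k + θ (k + 1) + θ (k + 2)) / 3 := fun k hk hkn =>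
    q_lin _ p s k (hw k hk hkn) rfl rfl rfl
  have hE : ∀ j, j ≤ n → alpha2 θ n j * (qMom θ (gMom θ fun i => p + s * θ i) (j + 1)
      - qMom θ (gMom θ fun i => p + s * θ i) j) = s * (θ (j + 2) - θ (j + 1)) ^ 2 / 3 :=
    fun j hj => E_lin h12 hn12 _ p s j hj (hw3 j) (fun h => hq j h hj)
      (fun h h' => hq (j+1) (by omega) (by omega))
  have hk := k.2
  have hz : ((Dmat θ 3 (n - 2) (n - 1) * Dmat θ 2 (n - 1) n) *ᵥ
      fun i : Fin n => gMom θ (fun i => p + s * θ i) (i.1 + 1)) = 0 := by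
    ext j
    have hj := j.2
    rw [D_mulVec hn, hq _ (by omega) (by omega), hq _ (by omega) (by omega),
      hq _ (by omega) (by omega)]
    have w1 := hw3 (j.1+1) (by omega) (by omega)
    have w2 := hw3 (j.1+2) (by omega) (by omega)
    simp only [add_assoc, Nat.reduceAdd, Pi.zero_apply] at w1 w2 ⊢
    field_simp
    ring
  rw [M_split (fun i : Fin n => gMom θ (fun i => p + s * θ i) (i.1 + 1)), hz,
    S2_vecMul _ hw, hE _ (by omega), hE _ (by omega), hq _ (by omega) (by omega)]
  simp only [Matrix.zero_vecMul, Pi.zero_apply, add_zero]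
  exact S_lin_alg p s _ _ _ (hw (k.1+1) (by omega) (by omega))

theorem lin_Fa (p s t0 t1 y : ℝ) (hy : y ∈ Set.Icc t0 t1) :
    p + s * y = p + s * t0 + (p + s * t1 - (p + s * t0)) * ((y - t0) / (t1 - t0)) := by
  rcases (hy.1.trans hy.2).eq_or_lt with h | h
  · subst h
    have : y = t0 := le_antisymm hy.2 hy.1
    subst this; simp
  · have : t1 - t0 ≠ 0 := sub_ne_zero.mpr h.ne'
    field_simp
    ring

theorem stmt_trunc (h1 : θ 1 = a) (h2 : θ 2 = a) (hn1 : θ (n + 1) = b) (hn2 : θ (n + 2) = b)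
    (hn : 2 ≤ n) (hstrict : ∀ i, 2 ≤ i → i ≤ n → θ i < θ (i + 1))
    (U : Matrix (Fin (n - 2)) (Fin (n - 2)) ℝ) (m : ℕ) (hmn : m + 3 ≤ n)
    (hU : ∀ k : Fin (n - 2), ((fun i : Fin (n - 2) => Nspl θ 4 (i.1 + 1) (θ (m + 3))) ᵥ* U) k =
      if k.1 = m then
        (θ (m + 3) - θ (m + 2)) ^ 2 * (θ (m + 4) - θ (m + 3)) ^ 2
          / (18 * (θ (m + 4) - θ (m + 2)))
      else 0) (k : Fin n) :
    ∑ i : Fin n, gMom θ (fun i => max (θ (m + 3) - θ i) 0) (i.1 + 1) *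
      (S2 θ n + (Dmat θ 3 (n - 2) (n - 1) * Dmat θ 2 (n - 1) n)ᵀ * U *
          (Dmat θ 3 (n - 2) (n - 1) * Dmat θ 2 (n - 1) n)) i k
      = max (θ (m + 3) - θ (k.1 + 2)) 0 := by
  have h12 : θ 1 = θ 2 := by rw [h1, h2]
  have hn12 : θ (n+1) = θ (n+2) := by rw [hn1, hn2]
  have hmo := kn_mono h12 hn12 hstrict
  have hs := kn_strict hn h12 hn12 hstrict
  have hw : ∀ k, 1 ≤ k → k ≤ n → θ (k + 2) - θ k ≠ 0 := fun k hk hkn =>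
    sub_ne_zero.mpr (hs k (k+2) hk (by omega) (by omega) (by omega) hkn).ne'
  have hw3 : ∀ k, 1 ≤ k → k ≤ n - 1 → θ (k + 3) - θ k ≠ 0 := fun k hk hkn =>
    sub_ne_zero.mpr (hs k (k+3) hk (by omega) (by omega) (by omega) (by omega)).ne'
  obtain ⟨c, hc⟩ : ∃ c : ℕ → ℝ, c = fun i => max (θ (m + 3) - θ i) 0 := ⟨_, rfl⟩
  have cl : ∀ i, 1 ≤ i → i ≤ m + 3 → c i = θ (m + 3) + (-1) * θ i := by
    intro i hi him
    have := hmo i (m+3) hi him (by omega)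
    rw [hc]
    simp only
    rw [max_eq_left (by linarith)]
    ring
  have cr : ∀ i, m + 3 ≤ i → i ≤ n + 2 → c i = 0 := by
    intro i hi him
    have := hmo (m+3) i (by omega) hi him
    rw [hc]
    simp only
    rw [max_eq_right (by linarith)]
  rw [← hc]
  have hck : max (θ (m + 3) - θ (k.1 + 2)) 0 = c (k.1 + 2) := by rw [hc]
  rw [hck]
  clear hck hc
  obtain ⟨q, hqdef⟩ : ∃ q, q = qMom θ (gMom θ c) := ⟨_, rfl⟩
  have ql : ∀ k, 1 ≤ k → k ≤ m + 1 → q k =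
      θ (m + 3) + (-1) * (θ k + θ (k + 1) + θ (k + 2)) / 3 := fun k hk hkn => by
    rw [hqdef]
    exact q_lin _ _ _ k (hw k hk (by omega)) (cl _ (by omega) (by omega))
      (cl _ (by omega) (by omega)) (cl _ (by omega) (by omega))
  have qm : q (m + 2) = (θ (m + 3) - θ (m + 2)) ^ 2 / (3 * (θ (m + 4) - θ (m + 2))) := by
    have := hw (m+2) (by omega) (by omega)
    rw [hqdef, qMom, gMom, cl (m+2) (by omega) (by omega), cr (m+2+1) (by omega) (by omega),
      cr (m+2+2) (by omega) (by omega)]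
    simp only [add_assoc, Nat.reduceAdd] at this ⊢
    field_simp
    ring
  have qr : ∀ k, m + 3 ≤ k → k ≤ n → q k = 0 := fun k hk hkn => by
    rw [hqdef, qMom, gMom, cr k hk (by omega), cr (k+1) (by omega) (by omega),
      cr (k+2) (by omega) (by omega)]
    simp
  have El : ∀ j, j ≤ m → alpha2 θ n j * (q (j + 1) - q j) =
      (-1) * (θ (j + 2) - θ (j + 1)) ^ 2 / 3 :=
    fun j hj => E_lin h12 hn12 _ (θ (m + 3)) (-1) j (by omega) (hw3 j)
      (fun h => ql j h (by omega)) (fun h h' => ql (j+1) (by omega) (by omega))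
  have Er : ∀ j, m + 3 ≤ j → j ≤ n → alpha2 θ n j * (q (j + 1) - q j) = 0 := by
    intro j hj hjn
    rcases Nat.lt_or_ge j n with h | h
    · rw [qr j hj hjn, qr (j+1) (by omega) (by omega)]; simp
    · have : ¬ (j ≤ n - 1) := by omega
      simp [alpha2, this]
  have hk := k.2
  have w1 := hw (m+1) (by omega) (by omega)
  have w2 := hw (m+2) (by omega) (by omega)
  have w3 := hw (m+3) (by omega) (by omega)
  have v1 := hw3 (m+1) (by omega) (by omega)
  have v2 := hw3 (m+2) (by omega) (by omega)
  have hz : ((Dmat θ 3 (n - 2) (n - 1) * Dmat θ 2 (n - 1) n) *ᵥ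
      fun i : Fin n => gMom θ c (i.1 + 1)) =
      fun i : Fin (n - 2) => Nspl θ 4 (i.1 + 1) (θ (m + 3)) := by
    ext j
    obtain ⟨j, hj⟩ := j
    rw [D_mulVec hn, ← hqdef, N4_expand]
    have hN := N1_knot hmo hstrict (m + 3) (by omega) hmn
    rw [hN _ (by omega) (by omega), hN _ (by omega) (by omega), hN _ (by omega) (by omega),
      hN _ (by omega) (by omega)]
    simp only [add_assoc, Nat.reduceAdd] at *
    have u1 := hw3 (j+1) (by omega) (by omega)
    have u2 := hw3 (j+2) (by omega) (by omega)
    simp only [add_assoc, Nat.reduceAdd] at u1 u2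
    rcases Nat.lt_or_ge (m+2) j with c1 | c1
    · rw [qr (j+1) (by omega) (by omega), qr (j+2) (by omega) (by omega),
        qr (j+3) (by omega) (by omega), if_neg (by omega), if_neg (by omega), if_neg (by omega),
        if_neg (by omega)]
      ring
    rcases Nat.lt_or_ge j (m - 1) with c2 | c2
    · rw [ql (j+1) (by omega) (by omega), ql (j+2) (by omega) (by omega),
        ql (j+3) (by omega) (by omega), if_neg (by omega), if_neg (by omega), if_neg (by omega),
        if_neg (by omega)]
      simp only [add_assoc, Nat.reduceAdd]
      field_simp
      ring
    have d1 := hs (m+2) (m+3) (by omega) (by omega) (by omega) (by omega) (by omega)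
    have d2 := hs (m+3) (m+4) (by omega) (by omega) (by omega) (by omega) (by omega)
    have cases : j = m + 2 ∨ j = m + 1 ∨ j = m ∨ j + 1 = m := by omega
    rcases cases with rfl | rfl | rfl | rfl
    · rw [qr _ (by omega) (by omega), qr _ (by omega) (by omega),
        qr _ (by omega) (by omega), if_pos (by omega), if_neg (by omega), if_neg (by omega),
        if_neg (by omega)]
      simp only [add_assoc, Nat.reduceAdd]
      rw [omega_self 3]
      ring
    · simp only [add_assoc, Nat.reduceAdd] at u1 u2 ⊢
      rw [qr (m+3) (by omega) (by omega),
        qr (m+4) (by omega) (by omega), qm, if_neg (by omega), if_pos trivial, if_neg (by omega),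
        if_neg (by omega), omega_self 1, omega_self 2,
        omega_pos 3 _ _ (hs _ _ (by omega) (by omega) (by omega) (by omega) (by omega)),
        omega_pos 2 _ _ (hs _ _ (by omega) (by omega) (by omega) (by omega) (by omega))]
      simp only [add_assoc, Nat.reduceAdd]
      field_simp
      ring
    · rw [qr (j+3) (by omega) (by omega), qm, ql (j+1) (by omega) (by omega),
        if_neg (by omega), if_neg (by omega), if_pos (by omega),
        if_neg (by omega), omega_self 1,
        omega_pos 3 (j+1) _ (hs _ _ (by omega) (by omega) (by omega) (by omega) (by omega)),
        omega_pos 3 (j+2) _ (hs _ _ (by omega) (by omega) (by omega) (by omega) (by omega)),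
        omega_pos 2 (j+1) _ (hs _ _ (by omega) (by omega) (by omega) (by omega) (by omega)),
        omega_pos 2 (j+2) _ (hs _ _ (by omega) (by omega) (by omega) (by omega) (by omega)),
        omega_self 2]
      simp only [add_assoc, Nat.reduceAdd]
      field_simp
      ring
    · simp only [add_assoc, Nat.reduceAdd] at *
      rw [qm, ql (j+1) (by omega) (by omega), ql (j+2) (by omega) (by omega),
        if_neg (by omega), if_neg (by omega), if_neg (by omega),
        if_pos trivial, omega_self 1,
        omega_pos 3 (j+1) _ (hs _ _ (by omega) (by omega) (by omega) (by omega) (by omega)),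
        omega_pos 3 (j+2) _ (hs _ _ (by omega) (by omega) (by omega) (by omega) (by omega)),
        omega_pos 2 (j+3) _ (hs _ _ (by omega) (by omega) (by omega) (by omega) (by omega))]
      simp only [add_assoc, Nat.reduceAdd]
      field_simp
      ring
  have hrow : ((fun i : Fin (n - 2) => Nspl θ 4 (i.1 + 1) (θ (m + 3))) ᵥ* U) =
      Pi.single (⟨m, by omega⟩ : Fin (n - 2)) ((θ (m + 3) - θ (m + 2)) ^ 2 *
        (θ (m + 4) - θ (m + 3)) ^ 2 / (18 * (θ (m + 4) - θ (m + 2)))) := by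
    ext i
    rw [hU, Pi.single_apply]
    simp only [Fin.ext_iff]
  rw [M_split (fun i : Fin n => gMom θ c (i.1 + 1)), hz, hrow, Matrix.single_vecMul,
    S2_vecMul _ hw, ← hqdef]
  simp only [Pi.smul_apply, smul_eq_mul, Matrix.row_apply]
  rw [D_entry hn]
  obtain ⟨k, hk'⟩ := k
  simp only
  have a1 : alpha2 θ n (m + 1) = (θ (m + 3) - θ (m + 2)) ^ 2 / (θ (m + 4) - θ (m + 1)) := by
    rw [alpha2, if_pos (by omega)]
  have a2 : alpha2 θ n (m + 2) = (θ (m + 4) - θ (m + 3)) ^ 2 / (θ (m + 5) - θ (m + 2)) := by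
    rw [alpha2, if_pos (by omega)]
  simp only [add_assoc, Nat.reduceAdd] at w1 w2 w3 v1 v2
  rcases Nat.lt_or_ge k m with c1 | c1
  · rw [if_neg (by omega), if_neg (by omega), if_neg (by omega), if_neg (by omega), El k (by omega),
      El (k+1) (by omega), ql (k+1) (by omega) (by omega), cl (k+2) (by omega) (by omega)]
    have := S_lin_alg (θ (m+3)) (-1) _ (θ (k+2)) _ (hw (k+1) (by omega) (by omega))
    simp only [add_assoc, Nat.reduceAdd] at this ⊢
    linarith
  rcases Nat.lt_or_ge (m+2) k with c2 | c2
  · rw [if_neg (by omega), if_neg (by omega), if_neg (by omega), if_neg (by omega),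
      Er k (by omega) (by omega), Er (k+1) (by omega) (by omega), qr _ (by omega) (by omega),
      cr _ (by omega) (by omega)]
    ring
  have cases : k = m ∨ k = m + 1 ∨ k = m + 2 := by omega
  rcases cases with rfl | rfl | rfl
  · rw [if_pos rfl, if_neg (by omega), if_neg (by omega), El k le_rfl, a1, qm,
      ql (k+1) (by omega) (by omega), cl (k+2) (by omega) (by omega)]
    simp only [add_assoc, Nat.reduceAdd]
    field_simp
    ring
  · rw [if_neg (by omega), if_pos rfl, if_pos rfl]
    simp only [add_assoc, Nat.reduceAdd]
    rw [qm, qr (m+3) (by omega) (by omega), a1, a2, ql (m+1) (by omega) (by omega),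
      cr (m+3) (by omega) (by omega)]
    simp only [add_assoc, Nat.reduceAdd]
    field_simp
    ring
  · rw [if_neg (by omega), if_neg (by omega), if_neg (by omega), if_pos rfl]
    have := Er (m+3) le_rfl (by omega)
    simp only [add_assoc, Nat.reduceAdd] at this ⊢
    rw [this, a2, qm, qr (m+3) (by omega) (by omega), cr (m+4) (by omega) (by omega)]
    field_simp
    ring

theorem trunc_Fa (hmo : ∀ i j, 1 ≤ i → i ≤ j → j ≤ n + 2 → θ i ≤ θ j) (l : ℕ) (hl : 1 ≤ l)
    (hln : l ≤ n) (i : ℕ) (hi : 1 ≤ i) (hin : i ≤ n + 1) (y : ℝ)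
    (hy : y ∈ Set.Icc (θ i) (θ (i + 1))) :
    max (θ l - y) 0 = max (θ l - θ i) 0 + (max (θ l - θ (i + 1)) 0 - max (θ l - θ i) 0) *
      ((y - θ i) / (θ (i + 1) - θ i)) := by
  rcases Nat.lt_or_ge i l with h | h
  · have e1 := hmo (i+1) l (by omega) (by omega) (by omega)
    have e2 := hmo i l (by omega) (by omega) (by omega)
    rw [max_eq_left (by linarith [hy.2]), max_eq_left (by linarith), max_eq_left (by linarith)]
    have := lin_Fa (θ l) (-1) _ _ y hy
    linarith
  · have e1 := hmo l i (by omega) (by omega) (by omega)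
    have e2 := hmo l (i+1) (by omega) (by omega) (by omega)
    rw [max_eq_right (by linarith [hy.1]), max_eq_right (by linarith), max_eq_right (by linarith)]
    ring

end helpers

/-- case `m = 2`. If `A U₂ = B` with `A = [N_{4,k}(θ_{ℓ_j})]` and the rows
of `B` the vectors `κ_{ℓ_j} e_{ℓ_j-2}ᵀ`, then the kernel
`L(x,y) = Φ₂(y) (S + D₂ᵀ D₃ᵀ U₂ D₃ D₂) Φ₂(x)ᵀ` reproduces all polynomials of degree at most 1
and all truncated powers `(θ_{ℓ_j} - x)₊`. -/
theorem stmt8 (a b : ℝ) (hab : a < b) (n : ℕ) (hn : 2 ≤ n) (θ : ℕ → ℝ)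
    (hθ1 : θ 1 = a) (hθ2 : θ 2 = a) (hθ3 : θ (n + 1) = b) (hθ4 : θ (n + 2) = b)
    (hstrict : ∀ i, 2 ≤ i → i ≤ n → θ i < θ (i + 1))
    (r : ℕ) (ℓ : Fin r → ℕ) (hmono : StrictMono ℓ)
    (hlb : ∀ j, 3 ≤ ℓ j) (hub : ∀ j, ℓ j ≤ n)
    (A B : Matrix (Fin r) (Fin (n - 2)) ℝ)
    (hA : ∀ j k, A j k = Nspl θ 4 (k.1 + 1) (θ (ℓ j)))
    (hB : ∀ j k, B j k =
      if k.1 + 1 = ℓ j - 2 then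
        (θ (ℓ j) - θ (ℓ j - 1)) ^ 2 * (θ (ℓ j + 1) - θ (ℓ j)) ^ 2
          / (18 * (θ (ℓ j + 1) - θ (ℓ j - 1)))
      else 0)
    (U : Matrix (Fin (n - 2)) (Fin (n - 2)) ℝ) (hU : A * U = B)
    (L : ℝ → ℝ → ℝ)
    (hL : ∀ x y, L x y = ∑ i : Fin n, ∑ k : Fin n,
      (S2 θ n + (Dmat θ 3 (n - 2) (n - 1) * Dmat θ 2 (n - 1) n)ᵀ * U *
          (Dmat θ 3 (n - 2) (n - 1) * Dmat θ 2 (n - 1) n)) i k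
        * Nspl θ 2 (i.1 + 1) y * Nspl θ 2 (k.1 + 1) x) :
    (∀ f : Polynomial ℝ, f.natDegree ≤ 1 → ∀ x ∈ Set.Ico a b,
        (∫ y in a..b, Polynomial.eval y f * L x y) = Polynomial.eval x f)
    ∧ (∀ j : Fin r, ∀ x ∈ Set.Ico a b,
        (∫ y in a..b, max (θ (ℓ j) - y) 0 * L x y) = max (θ (ℓ j) - x) 0) := by
  have h12 : θ 1 = θ 2 := by rw [hθ1, hθ2]
  have hn12 : θ (n+1) = θ (n+2) := by rw [hθ3, hθ4]
  have hmo := kn_mono h12 hn12 hstrict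
  refine ⟨?_, ?_⟩
  · intro f hf x hx
    have hfe : ∀ y, Polynomial.eval y f = f.coeff 0 + f.coeff 1 * y := by
      intro y
      conv_lhs => rw [Polynomial.eq_X_add_C_of_natDegree_le_one hf]
      simp
      ring
    simp only [hfe, hL]
    exact fin_gen hθ1 hθ2 hθ3 hθ4 hmo (fun y => f.coeff 0 + f.coeff 1 * y) (by fun_prop)
      (fun i _ _ y hy => lin_Fa _ _ _ _ y hy) _
      (fun k => stmt_poly hθ1 hθ2 hθ3 hθ4 hn hstrict U _ _ k) x hx
  · intro j x hx
    have hj1 := hlb j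
    have hj2 := hub j
    have hrow : ∀ k, (A j ᵥ* U) k = B j k := by
      intro k
      rw [← hU]
      rfl
    have hAj : A j = fun k : Fin (n - 2) => Nspl θ 4 (k.1 + 1) (θ (ℓ j)) := by
      ext k; exact hA j k
    have hBj := hB j
    rw [hAj] at hrow
    generalize ℓ j = l at *
    obtain ⟨m, rfl⟩ : ∃ m, l = m + 3 := ⟨l - 3, by omega⟩
    simp only [hL]
    refine fin_gen hθ1 hθ2 hθ3 hθ4 hmo (fun y => max (θ (m + 3) - y) 0) (by fun_prop)
      (fun i h h' y hy => trunc_Fa hmo (m+3) (by omega) hj2 i h h' y hy) _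
      (fun k => stmt_trunc hθ1 hθ2 hθ3 hθ4 hn hstrict U m hj2 ?_ k) x hx
    intro k
    rw [hrow, hBj]
    rw [show m + 3 - 2 = m + 1 from rfl, show m + 3 - 1 = m + 2 from rfl]
    simp only [Nat.add_right_cancel_iff]
end
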